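/- (Strict hierarchy of valuation equivalences and congruences) The inclusions ≡_fr ⊆ ≡_rp ⊆ ≡_cr ⊆ ≡_wm ⊆ ≡_mem ⊆ ≡_st between the equivalences on propositional statements are all proper, and for each K ∈ {fr, rp, cr, wm, mem} the inclusion =_K ⊆ ≡_K is also proper. -/

import Mathlib

/-- Propositional statements over atoms `A`: constants `T`, `F`, an atom `a`
for each `a ∈ A`, and the ternary conditional composition
`cond x y z = x ◁ y ▷ z` (with `y` the central condition). -/
inductive PS (A : Type) : Type where
  | tt : PS A
  | ff : PS A
  | atom : A → PS A
  | cond : PS A → PS A → PS A → PS A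

/-- A valuation algebra (VA) over `A`. -/
structure VA (A : Type) where
  Val : Type
  Tv : Val
  Fv : Val
  yd : A → Val → Bool
  dv : A → Val → Val
  yd_T : ∀ a, yd a Tv = true
  yd_F : ∀ a, yd a Fv = false
  dv_T : ∀ a, dv a Tv = Tv
  dv_F : ∀ a, dv a Fv = Fv

variable {A : Type}

mutual
  /-- Evaluation `P/H` of a propositional statement over a valuation `H`. -/
  def PS.eval (V : VA A) : PS A → V.Val → Bool
    | .tt, _ => true
    | .ff, _ => false
    | .atom a, H => V.yd a H
    | .cond p q r, H =>
        if PS.eval V q H then PS.eval V p (PS.deriv V q H)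
        else PS.eval V r (PS.deriv V q H)
  /-- The generalized derivative `∂_P(H)`. -/
  def PS.deriv (V : VA A) : PS A → V.Val → V.Val
    | .tt, H => H
    | .ff, H => H
    | .atom a, H => V.dv a H
    | .cond p q r, H =>
        if PS.eval V q H then PS.deriv V p (PS.deriv V q H)
        else PS.deriv V r (PS.deriv V q H)
end

/-- `K`-equivalence: equal evaluation results in all members of the class `K`. -/
def KEquiv (K : VA A → Prop) (P Q : PS A) : Prop :=
  ∀ V : VA A, K V → ∀ H : V.Val, PS.eval V P H = PS.eval V Q H

/-- A congruence with respect to conditional composition. -/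
def IsCondCongruence (R : PS A → PS A → Prop) : Prop :=
  Equivalence R ∧
    ∀ ⦃x x' y y' z z' : PS A⦄, R x x' → R y y' → R z z' →
      R (PS.cond x y z) (PS.cond x' y' z')

/-- `K`-congruence: the largest congruence contained in `K`-equivalence. -/
def KCong (K : VA A → Prop) (P Q : PS A) : Prop :=
  ∃ R : PS A → PS A → Prop,
    IsCondCongruence R ∧ (∀ x y, R x y → KEquiv K x y) ∧ R P Q

/-- Derivability (of closed equations) in equational logic from the axioms `CP`
together with an additional set `Ax` of equational axioms. -/
inductive Deriv (Ax : PS A → PS A → Prop) : PS A → PS A → Prop where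
  | ax {p q} : Ax p q → Deriv Ax p q
  | cp1 (x y) : Deriv Ax (.cond x .tt y) x
  | cp2 (x y) : Deriv Ax (.cond x .ff y) y
  | cp3 (x) : Deriv Ax (.cond .tt x .ff) x
  | cp4 (x y z u v) :
      Deriv Ax (.cond x (.cond y z u) v)
               (.cond (.cond x y v) z (.cond x u v))
  | refl (x) : Deriv Ax x x
  | symm {p q} : Deriv Ax p q → Deriv Ax q p
  | trans {p q r} : Deriv Ax p q → Deriv Ax q r → Deriv Ax p r
  | congr {x x' y y' z z'} : Deriv Ax x x' → Deriv Ax y y' → Deriv Ax z z' →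
      Deriv Ax (.cond x y z) (.cond x' y' z')

/-- No additional axioms: plain `CP`. -/
def NoAx : PS A → PS A → Prop := fun _ _ => False

/-- The class `fr` of free valuation algebras: all VAs. -/
def frK : VA A → Prop := fun _ => True

/-- The class `rp` of repetition-proof VAs. -/
def rpK (V : VA A) : Prop :=
  ∀ (a : A) (x : V.Val), V.yd a x = V.yd a (V.dv a x)

/-- The class `cr` of contractive VAs. -/
def crK (V : VA A) : Prop :=
  rpK V ∧ ∀ (a : A) (x : V.Val), V.dv a (V.dv a x) = V.dv a x

/-- The class `wm` of weakly memorizing VAs. -/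
def wmK (V : VA A) : Prop :=
  crK V ∧ ∀ (a b : A) (x : V.Val),
    V.yd b (V.dv a x) = V.yd a x →
      V.dv a (V.dv b (V.dv a x)) = V.dv b (V.dv a x) ∧
      V.yd a (V.dv b (V.dv a x)) = V.yd a x

/-- The class `mem` of memorizing VAs. -/
def memK (V : VA A) : Prop :=
  crK V ∧ ∀ (a b : A) (x : V.Val),
    V.dv a (V.dv b (V.dv a x)) = V.dv b (V.dv a x) ∧
    V.yd a (V.dv b (V.dv a x)) = V.yd a x

/-- The class `st` of static VAs. -/
def stK (V : VA A) : Prop :=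
  ∀ (a b : A) (x : V.Val), V.yd a (V.dv b x) = V.yd a x

theorem memK.wmK {V : VA A} (h : memK V) : wmK V :=
  ⟨h.1, fun a b x _ => h.2 a b x⟩

theorem KEquiv.mono {K L : VA A → Prop} (hLK : ∀ V, L V → K V) {P Q : PS A}
    (h : KEquiv K P Q) : KEquiv L P Q :=
  fun V hV => h V (hLK V hV)

theorem KCong.kEquiv {K : VA A → Prop} {P Q : PS A} (h : KCong K P Q) : KEquiv K P Q := by
  obtain ⟨R, -, hRK, hPQ⟩ := h
  exact hRK P Q hPQ

theorem KCong.cond_right {K : VA A → Prop} {P Q : PS A} (h : KCong K P Q) (x y : PS A) :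
    KEquiv K (.cond x P y) (.cond x Q y) := by
  obtain ⟨R, ⟨hR, hcond⟩, hRK, hPQ⟩ := h
  exact hRK _ _ (hcond (hR.refl x) hPQ (hR.refl y))

/-- Homomorphisms of valuation algebras commute with evaluation and derivatives. -/
theorem PS.eval_deriv_map {V W : VA A} (f : V.Val → W.Val)
    (hy : ∀ a x, W.yd a (f x) = V.yd a x) (hd : ∀ a x, W.dv a (f x) = f (V.dv a x))
    (P : PS A) (H : V.Val) :
    PS.eval W P (f H) = PS.eval V P H ∧ PS.deriv W P (f H) = f (PS.deriv V P H) := by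
  induction P generalizing H with
  | tt => simp [PS.eval, PS.deriv]
  | ff => simp [PS.eval, PS.deriv]
  | atom a => simp [PS.eval, PS.deriv, hy, hd]
  | cond p q r ihp ihq ihr =>
    simp only [PS.eval, PS.deriv, ihq, ihp, ihr]
    split <;> simp

/-- Boolean assignments with trivial derivatives. -/
def VA.assignments (A : Type) : VA A where
  Val := A → Bool
  Tv := fun _ => true
  Fv := fun _ => false
  yd := fun a x => x a
  dv := fun _ x => x
  yd_T := fun _ => rfl
  yd_F := fun _ => rfl
  dv_T := fun _ => rfl
  dv_F := fun _ => rfl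

theorem VA.memK_assignments : memK (VA.assignments A) :=
  ⟨⟨fun _ _ => rfl, fun _ _ => rfl⟩, fun _ _ _ => ⟨rfl, rfl⟩⟩

theorem KEquiv.stK_of_memK {P Q : PS A} (h : KEquiv memK P Q) : KEquiv stK P Q := by
  intro V hV H
  have key (R : PS A) := (PS.eval_deriv_map (W := VA.assignments A) (fun x a => V.yd a x)
    (fun _ _ => rfl) (fun b x => funext fun a => (hV a b x).symm) R H).1
  rw [← key P, ← key Q]
  exact h _ VA.memK_assignments _

/-- Two states `inr true` and `inr false`, together with the constant valuations `inl true`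
and `inl false`. -/
def VA.twoState (y : A → Bool → Bool) (d : A → Bool → Bool ⊕ Bool) : VA A where
  Val := Bool ⊕ Bool
  Tv := .inl true
  Fv := .inl false
  yd := fun a => Sum.elim id (y a)
  dv := fun a => Sum.elim .inl (d a)
  yd_T := fun _ => rfl
  yd_F := fun _ => rfl
  dv_T := fun _ => rfl
  dv_F := fun _ => rfl

theorem exists_kEquiv_rpK_not_frK (a : A) :
    ∃ P Q : PS A, KEquiv rpK P Q ∧ ¬ KEquiv frK P Q := by
  refine ⟨.cond (.atom a) (.atom a) .ff, .atom a, ?_, ?_⟩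
  · intro V hV H
    simp [PS.eval, PS.deriv, ← hV a H]
  · intro h
    have := h (VA.twoState (fun _ s => s) (fun _ _ => .inr false)) trivial (.inr true)
    simp [PS.eval, PS.deriv, VA.twoState] at this

open Classical in
theorem exists_kEquiv_crK_not_rpK {a b : A} (hab : a ≠ b) :
    ∃ P Q : PS A, KEquiv crK P Q ∧ ¬ KEquiv rpK P Q := by
  let Q : PS A := .cond (.atom b) (.atom a) (.atom b)
  refine ⟨.cond Q (.atom a) Q, Q, ?_, ?_⟩
  · intro V hV H
    simp only [Q, PS.eval, PS.deriv, hV.2 a H]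
    grind
  · intro h
    have := h (VA.twoState (fun c s => if c = b then s else true)
      (fun c s => .inr (if c = a then !s else s))) ?_ (.inr true)
    · simp [Q, PS.eval, PS.deriv, VA.twoState] at this
    · rintro c (s | s)
      · rfl
      · by_cases hb : c = b
        · subst hb; simp [VA.twoState, hab.symm]
        · simp [VA.twoState, hb]

open Classical in
theorem exists_kEquiv_wmK_not_crK {a b : A} (hab : a ≠ b) :
    ∃ P Q : PS A, KEquiv wmK P Q ∧ ¬ KEquiv crK P Q := by
  refine ⟨.cond (.cond (.atom a) (.atom b) .ff) (.atom a) .ff,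
    .cond (.atom b) (.atom a) .ff, ?_, ?_⟩
  · intro V hV H
    have := hV.2 a b H
    simp only [PS.eval, PS.deriv]
    grind
  · intro h
    have := h (VA.twoState (fun c s => if c = a then s else true)
      (fun c s => .inr (if c = b then false else s))) ?_ (.inr true)
    · simp [PS.eval, PS.deriv, VA.twoState, hab, hab.symm] at this
    · refine ⟨?_, ?_⟩ <;> rintro c (s | s)
      · simp [VA.twoState]
      · simp [VA.twoState]
        grind
      · simp [VA.twoState]
      · simp [VA.twoState]

open Classical in
theorem exists_kEquiv_memK_not_wmK {a b : A} (hab : a ≠ b) :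
    ∃ P Q : PS A, KEquiv memK P Q ∧ ¬ KEquiv wmK P Q := by
  refine ⟨.cond (.cond .tt (.atom b) (.atom a)) (.atom a) .ff, .atom a, ?_, ?_⟩
  · intro V hV H
    have := hV.2 a b H
    simp only [PS.eval, PS.deriv]
    grind
  · intro h
    have := h (VA.twoState (fun c s => if c = a then s else false)
      (fun c s => .inr (if c = b then false else s))) ?_ (.inr true)
    · simp [PS.eval, PS.deriv, VA.twoState, hab, hab.symm] at this
    · refine ⟨⟨?_, ?_⟩, ?_⟩
      · rintro c (s | s)
        · simp [VA.twoState]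
        · simp [VA.twoState]
          grind
      · rintro c (s | s) <;> simp [VA.twoState]
      · rintro c d (s | s)
        · simp [VA.twoState]
        · simp [VA.twoState]
          grind

open Classical in
theorem exists_memK_yd_dv_ne {a b : A} (hab : a ≠ b) :
    ∃ V : VA A, memK V ∧ ∃ H : V.Val, V.yd b (V.dv a H) ≠ V.yd b H := by
  refine ⟨VA.twoState (fun c s => if c = b then s else true)
    (fun c s => if c = a then .inr false else if c = b ∧ s then .inl true else .inr s), ?_,
    .inr true, ?_⟩
  · refine ⟨⟨?_, ?_⟩, ?_⟩
    · rintro c (s | s)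
      · simp [VA.twoState]
      · simp [VA.twoState]
        grind
    · rintro c (s | s)
      · simp [VA.twoState]
      · simp [VA.twoState]
        grind
    · rintro c d (s | s)
      · simp [VA.twoState]
      · simp [VA.twoState]
        grind
  · simp [VA.twoState]

theorem exists_kEquiv_stK_not_memK {a b : A} (hab : a ≠ b) :
    ∃ P Q : PS A, KEquiv stK P Q ∧ ¬ KEquiv memK P Q := by
  refine ⟨.cond (.atom b) (.atom a) (.atom b), .atom b, ?_, ?_⟩
  · intro V hV H
    simp only [PS.eval, PS.deriv, hV b a H]
    grind
  · intro h
    obtain ⟨V, hV, H, hne⟩ := exists_memK_yd_dv_ne hab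
    have := h V hV H
    simp only [PS.eval, PS.deriv] at this
    grind

theorem exists_kEquiv_not_kCong {a b : A} (hab : a ≠ b) {K : VA A → Prop}
    (hK : ∀ V, memK V → K V) : ∃ P Q : PS A, KEquiv K P Q ∧ ¬ KCong K P Q := by
  refine ⟨.cond .tt (.atom a) .tt, .tt, ?_, ?_⟩
  · intro V _ H
    simp only [PS.eval]
    grind
  · intro h
    obtain ⟨V, hV, H, hne⟩ := exists_memK_yd_dv_ne hab
    have := h.cond_right (.atom b) (.atom b) V (hK V hV) H
    simp only [PS.eval, PS.deriv] at this
    grind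

/-- **Strict hierarchy of valuation equivalences and congruences**: the
inclusions `≡_fr ⊆ ≡_rp ⊆ ≡_cr ⊆ ≡_wm ⊆ ≡_mem ⊆ ≡_st` are all proper, and
for each `K ∈ {fr, rp, cr, wm, mem}` the inclusion `=_K ⊆ ≡_K` is proper. -/
theorem hierarchy_proper {A : Type} [Countable A] [Nontrivial A] :
    ((∀ P Q : PS A, KEquiv frK P Q → KEquiv rpK P Q) ∧
      ∃ P Q : PS A, KEquiv rpK P Q ∧ ¬ KEquiv frK P Q) ∧
    ((∀ P Q : PS A, KEquiv rpK P Q → KEquiv crK P Q) ∧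
      ∃ P Q : PS A, KEquiv crK P Q ∧ ¬ KEquiv rpK P Q) ∧
    ((∀ P Q : PS A, KEquiv crK P Q → KEquiv wmK P Q) ∧
      ∃ P Q : PS A, KEquiv wmK P Q ∧ ¬ KEquiv crK P Q) ∧
    ((∀ P Q : PS A, KEquiv wmK P Q → KEquiv memK P Q) ∧
      ∃ P Q : PS A, KEquiv memK P Q ∧ ¬ KEquiv wmK P Q) ∧
    ((∀ P Q : PS A, KEquiv memK P Q → KEquiv stK P Q) ∧
      ∃ P Q : PS A, KEquiv stK P Q ∧ ¬ KEquiv memK P Q) ∧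
    ((∀ P Q : PS A, KCong frK P Q → KEquiv frK P Q) ∧
      ∃ P Q : PS A, KEquiv frK P Q ∧ ¬ KCong frK P Q) ∧
    ((∀ P Q : PS A, KCong rpK P Q → KEquiv rpK P Q) ∧
      ∃ P Q : PS A, KEquiv rpK P Q ∧ ¬ KCong rpK P Q) ∧
    ((∀ P Q : PS A, KCong crK P Q → KEquiv crK P Q) ∧
      ∃ P Q : PS A, KEquiv crK P Q ∧ ¬ KCong crK P Q) ∧
    ((∀ P Q : PS A, KCong wmK P Q → KEquiv wmK P Q) ∧
      ∃ P Q : PS A, KEquiv wmK P Q ∧ ¬ KCong wmK P Q) ∧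
    ((∀ P Q : PS A, KCong memK P Q → KEquiv memK P Q) ∧
      ∃ P Q : PS A, KEquiv memK P Q ∧ ¬ KCong memK P Q) := by
  obtain ⟨a, b, hab⟩ := exists_pair_ne A
  exact
    ⟨⟨fun _ _ => .mono fun _ _ => trivial, exists_kEquiv_rpK_not_frK a⟩,
      ⟨fun _ _ => .mono fun _ h => h.1, exists_kEquiv_crK_not_rpK hab⟩,
      ⟨fun _ _ => .mono fun _ h => h.1, exists_kEquiv_wmK_not_crK hab⟩,
      ⟨fun _ _ => .mono fun _ h => h.wmK, exists_kEquiv_memK_not_wmK hab⟩,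
      ⟨fun _ _ => KEquiv.stK_of_memK, exists_kEquiv_stK_not_memK hab⟩,
      ⟨fun _ _ => KCong.kEquiv, exists_kEquiv_not_kCong hab fun _ _ => trivial⟩,
      ⟨fun _ _ => KCong.kEquiv, exists_kEquiv_not_kCong hab fun _ h => h.1.1⟩,
      ⟨fun _ _ => KCong.kEquiv, exists_kEquiv_not_kCong hab fun _ h => h.1⟩,
      ⟨fun _ _ => KCong.kEquiv, exists_kEquiv_not_kCong hab fun _ h => h.wmK⟩,
      ⟨fun _ _ => KCong.kEquiv, exists_kEquiv_not_kCong hab fun _ h => h⟩⟩
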